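/- arXiv:1204.2504 — 3 statements merged into one kernel-verified Lean document; each statement's English description precedes it below -/
import Mathlib

section
/- Let φ and ψ be C^2 orientation-preserving diffeomorphisms of [0,1] fixing 0 and 1, with Dφ>0 and Dψ>0. Then for all x ∈ [0,1]: e^{-‖φ-ψ‖} ≤ Dφ(x)/Dψ(x) ≤ e^{‖φ-ψ‖}, where ‖φ-ψ‖ = sup_{x∈[0,1]} |N_φ(x) − N_ψ(x)|. -/
/-- The nonlinearity `N_φ = φ''/φ'` of a map of `[0,1]`. -/
noncomputable def nonlin (φ : ℝ → ℝ) (x : ℝ) : ℝ :=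
  derivWithin (derivWithin φ (Set.Icc 0 1)) (Set.Icc 0 1) x /
    derivWithin φ (Set.Icc 0 1) x

/-- `‖φ - ψ‖ = sup_{x ∈ [0,1]} |N_φ(x) - N_ψ(x)|` (the norm of the difference in
the linear structure induced by the nonlinearity operator). -/
noncomputable def nonlinDiffNorm (φ ψ : ℝ → ℝ) : ℝ :=
  sSup ((fun t => |nonlin φ t - nonlin ψ t|) '' Set.Icc 0 1)

/-- The derivative of a `C²` map of `[0,1]` is `C¹`. -/
lemma contDiffOn_one_derivWithin {φ : ℝ → ℝ} (hφ : ContDiffOn ℝ 2 φ (Set.Icc 0 1)) :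
    ContDiffOn ℝ 1 (derivWithin φ (Set.Icc 0 1)) (Set.Icc 0 1) :=
  hφ.derivWithin (uniqueDiffOn_Icc zero_lt_one) (by norm_num)

/-- The nonlinearity is the derivative of `log φ'`. -/
lemma hasDerivWithinAt_log_derivWithin {φ : ℝ → ℝ} (hφ : ContDiffOn ℝ 2 φ (Set.Icc 0 1))
    {x : ℝ} (hx : x ∈ Set.Icc (0:ℝ) 1) (hd : derivWithin φ (Set.Icc 0 1) x ≠ 0) :
    HasDerivWithinAt (fun t => Real.log (derivWithin φ (Set.Icc 0 1) t)) (nonlin φ x)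
      (Set.Icc 0 1) x :=
  (((contDiffOn_one_derivWithin hφ).differentiableOn one_ne_zero) x hx).hasDerivWithinAt.log hd

lemma continuousOn_nonlin {φ : ℝ → ℝ} (hφ : ContDiffOn ℝ 2 φ (Set.Icc 0 1))
    (hd : ∀ x ∈ Set.Icc (0:ℝ) 1, derivWithin φ (Set.Icc 0 1) x ≠ 0) :
    ContinuousOn (nonlin φ) (Set.Icc 0 1) :=
  ((contDiffOn_one_derivWithin hφ).continuousOn_derivWithin
    (uniqueDiffOn_Icc zero_lt_one) le_rfl).div (contDiffOn_one_derivWithin hφ).continuousOn hd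

lemma abs_nonlin_sub_le_nonlinDiffNorm {φ ψ : ℝ → ℝ}
    (hφ : ContinuousOn (nonlin φ) (Set.Icc 0 1)) (hψ : ContinuousOn (nonlin ψ) (Set.Icc 0 1))
    {x : ℝ} (hx : x ∈ Set.Icc (0:ℝ) 1) :
    |nonlin φ x - nonlin ψ x| ≤ nonlinDiffNorm φ ψ :=
  le_csSup (isCompact_Icc.image_of_continuousOn (hφ.sub hψ).abs).bddAbove ⟨x, hx, rfl⟩

/-- Two differentiable maps of `[0,1]` with the same endpoint values have equal derivatives
somewhere. -/
lemma exists_derivWithin_eq {φ ψ : ℝ → ℝ} (hφ : DifferentiableOn ℝ φ (Set.Icc 0 1))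
    (hψ : DifferentiableOn ℝ ψ (Set.Icc 0 1)) (h0 : φ 0 = ψ 0) (h1 : φ 1 = ψ 1) :
    ∃ c ∈ Set.Icc (0:ℝ) 1, derivWithin φ (Set.Icc 0 1) c = derivWithin ψ (Set.Icc 0 1) c := by
  have hd : ∀ f : ℝ → ℝ, DifferentiableOn ℝ f (Set.Icc 0 1) → ∀ x ∈ Set.Ioo (0:ℝ) 1,
      HasDerivAt f (derivWithin f (Set.Icc 0 1) x) x := fun f hf x hx =>
    (hf x (Set.Ioo_subset_Icc_self hx)).hasDerivWithinAt.hasDerivAt (Icc_mem_nhds hx.1 hx.2)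
  obtain ⟨c, hc, h⟩ := exists_hasDerivAt_eq_zero zero_lt_one
    (hφ.continuousOn.sub hψ.continuousOn) (by simp [h0, h1])
    fun x hx => (hd φ hφ x hx).sub (hd ψ hψ x hx)
  exact ⟨c, Set.Ioo_subset_Icc_self hc, sub_eq_zero.mp h⟩

/-- For C² orientation-preserving diffeomorphisms `φ, ψ` of `[0,1]` fixing `0` and `1`,
`e^{-‖φ-ψ‖} ≤ Dφ(x)/Dψ(x) ≤ e^{‖φ-ψ‖}` for all `x ∈ [0,1]`. -/
theorem deriv_ratio_nonlin_diff_bound (φ ψ : ℝ → ℝ)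
    (hφ : ContDiffOn ℝ 2 φ (Set.Icc 0 1)) (hψ : ContDiffOn ℝ 2 ψ (Set.Icc 0 1))
    (hφ0 : φ 0 = 0) (hφ1 : φ 1 = 1) (hψ0 : ψ 0 = 0) (hψ1 : ψ 1 = 1)
    (hφd : ∀ x ∈ Set.Icc (0:ℝ) 1, 0 < derivWithin φ (Set.Icc 0 1) x)
    (hψd : ∀ x ∈ Set.Icc (0:ℝ) 1, 0 < derivWithin ψ (Set.Icc 0 1) x) :
    ∀ x ∈ Set.Icc (0:ℝ) 1,
      Real.exp (-(nonlinDiffNorm φ ψ)) ≤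
          derivWithin φ (Set.Icc 0 1) x / derivWithin ψ (Set.Icc 0 1) x ∧
        derivWithin φ (Set.Icc 0 1) x / derivWithin ψ (Set.Icc 0 1) x ≤
          Real.exp (nonlinDiffNorm φ ψ) := by
  intro x hx
  obtain ⟨c, hc, hceq⟩ := exists_derivWithin_eq (hφ.differentiableOn two_ne_zero)
    (hψ.differentiableOn two_ne_zero) (hφ0.trans hψ0.symm) (hφ1.trans hψ1.symm)
  have hbound := fun t (ht : t ∈ Set.Icc (0:ℝ) 1) => abs_nonlin_sub_le_nonlinDiffNorm
    (continuousOn_nonlin hφ fun y hy => (hφd y hy).ne')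
    (continuousOn_nonlin hψ fun y hy => (hψd y hy).ne') ht
  have hmvt := (convex_Icc (0:ℝ) 1).norm_image_sub_le_of_norm_hasDerivWithin_le
    (fun t ht => (hasDerivWithinAt_log_derivWithin hφ ht (hφd t ht).ne').sub
      (hasDerivWithinAt_log_derivWithin hψ ht (hψd t ht).ne')) hbound hc hx
  simp only [Pi.sub_apply, hceq, sub_self, sub_zero, Real.norm_eq_abs] at hmvt
  have hdist : |x - c| ≤ 1 :=
    abs_le.mpr ⟨by linarith [hx.1, hc.2], by linarith [hx.2, hc.1]⟩
  have hle := abs_le.mp (hmvt.trans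
    (mul_le_of_le_one_right ((abs_nonneg _).trans (hbound x hx)) hdist))
  rw [← Real.log_div (hφd x hx).ne' (hψd x hx).ne'] at hle
  have hpos := div_pos (hφd x hx) (hψd x hx)
  exact ⟨(Real.le_log_iff_exp_le hpos).mp hle.1, (Real.log_le_iff_le_exp hpos).mp hle.2⟩
end

section
/- Let π>0 and let f ∈ K^π be a C^1 Lorenz map that is renormalizable of monotone combinatorial type (0 1^n, 1 0^m) with renormalization intervals L=[p,c), R=(c,q]. Then |p − f_0^{-1}(c)| ≥ Δ and |q − f_1^{-1}(c)| ≥ Θ. -/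
open Set

/-- The Lorenz map `f = (u,v,c,φ,ψ)` with critical exponent `ρ`:
`f(x) = φ(u(1-((c-x)/c)^ρ))` for `x < c` and `f(x) = ψ(1+v(-1+((x-c)/(1-c))^ρ))`
for `x ≥ c` (by convention, at the critical point `c` we take the right branch). -/
noncomputable def lorenzF (ρ u v c : ℝ) (φ ψ : ℝ → ℝ) : ℝ → ℝ := fun x =>
  if x < c then φ (u * (1 - ((c - x) / c) ^ ρ))
  else ψ (1 + v * (-1 + ((x - c) / (1 - c)) ^ ρ))

/-- The data `(u,v,c,φ,ψ)` of a Cᵏ Lorenz map with critical exponent `ρ > 1`: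
`u,v ∈ (0,1]`, `c ∈ (0,1)`, and `φ, ψ` are Cᵏ orientation-preserving
diffeomorphisms of `[0,1]` fixing `0` and `1`. -/
structure IsLorenz (k : ℕ) (ρ u v c : ℝ) (φ ψ : ℝ → ℝ) : Prop where
  one_lt_rho : 1 < ρ
  u_pos : 0 < u
  u_le_one : u ≤ 1
  v_pos : 0 < v
  v_le_one : v ≤ 1
  c_pos : 0 < c
  c_lt_one : c < 1
  phi_smooth : ContDiffOn ℝ k φ (Icc 0 1)
  psi_smooth : ContDiffOn ℝ k ψ (Icc 0 1)
  phi_zero : φ 0 = 0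
  phi_one : φ 1 = 1
  psi_zero : ψ 0 = 0
  psi_one : ψ 1 = 1
  phi_deriv_pos : ∀ x ∈ Icc (0:ℝ) 1, 0 < derivWithin φ (Icc 0 1) x
  psi_deriv_pos : ∀ x ∈ Icc (0:ℝ) 1, 0 < derivWithin ψ (Icc 0 1) x

/-- `dist[φ] ≤ π`: the distortion bound `log (Dφ(y)/Dφ(x)) ≤ π` for all `x,y ∈ [0,1]`. -/
def DistBound (φ : ℝ → ℝ) (π : ℝ) : Prop :=
  ∀ x ∈ Icc (0:ℝ) 1, ∀ y ∈ Icc (0:ℝ) 1,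
    Real.log (derivWithin φ (Icc 0 1) y / derivWithin φ (Icc 0 1) x) ≤ π

/-- `f = (u,v,c,φ,ψ)` is renormalizable of monotone combinatorial type
`(0 1^n, 1 0^m)` with renormalization intervals `L = [p,c)`, `R = (c,q]`,
`C = [p,q]`: `f^{n+1}` maps `L` into `C` fixing `p`, `f^{m+1}` maps `R` into `C`
fixing `q`, these are first returns (the intermediate iterates of `L` lie in
`(c,1]` and those of `R` in `[0,c)`, all disjoint from `C`), and the rescaled
first return map is a nontrivial Lorenz map (its critical values lie on opposite
sides of its critical point). -/
structure MonotoneRenorm (ρ u v c : ℝ) (φ ψ : ℝ → ℝ) (n m : ℕ) (p q : ℝ) : Prop where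
  n_pos : 1 ≤ n
  m_pos : 1 ≤ m
  p_pos : 0 < p
  p_lt_c : p < c
  c_lt_q : c < q
  q_lt_one : q < 1
  left_return : MapsTo (lorenzF ρ u v c φ ψ)^[n + 1] (Ico p c) (Icc p q)
  left_fix : (lorenzF ρ u v c φ ψ)^[n + 1] p = p
  right_return : MapsTo (lorenzF ρ u v c φ ψ)^[m + 1] (Ioc c q) (Icc p q)
  right_fix : (lorenzF ρ u v c φ ψ)^[m + 1] q = q
  left_iter : ∀ k, 1 ≤ k → k ≤ n →
    (lorenzF ρ u v c φ ψ)^[k] '' Ico p c ⊆ Ioc c 1 ∧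
      Disjoint ((lorenzF ρ u v c φ ψ)^[k] '' Ico p c) (Icc p q)
  right_iter : ∀ k, 1 ≤ k → k ≤ m →
    (lorenzF ρ u v c φ ψ)^[k] '' Ioc c q ⊆ Ico 0 c ∧
      Disjoint ((lorenzF ρ u v c φ ψ)^[k] '' Ioc c q) (Icc p q)
  nontrivial_left : c < (lorenzF ρ u v c φ ψ)^[n] (φ u)
  nontrivial_right : (lorenzF ρ u v c φ ψ)^[m] (ψ (1 - v)) < c

/-- `κ = e^{-π} c / (c₁⁻ ρ)`. -/
noncomputable def kappaC (ρ π c c1m : ℝ) : ℝ := Real.exp (-π) * c / (c1m * ρ)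

/-- `η = e^{-π} μ / ((1-c₁⁺) ρ)`, where `μ = 1 - c`. -/
noncomputable def etaC (ρ π c c1p : ℝ) : ℝ := Real.exp (-π) * (1 - c) / ((1 - c1p) * ρ)

/-- `ν = μ / (1-c₁⁺)^{1/ρ}`. -/
noncomputable def nuC (ρ c c1p : ℝ) : ℝ := (1 - c) / (1 - c1p) ^ (1 / ρ)

/-- `ξ = c / (c₁⁻)^{1/ρ}`. -/
noncomputable def xiC (ρ c c1m : ℝ) : ℝ := c / c1m ^ (1 / ρ)

/-- `γ = e^{2π}/ρ`. -/
noncomputable def gammaC (ρ π : ℝ) : ℝ := Real.exp (2 * π) / ρ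

/-- `Δ = (κ (c/(c-c₁⁺))^{ρ-1} ν^{ρ/(ρ-1)} e^{-π/(ρ-1)})^{ρⁿ/(ρⁿ-1)}`. -/
noncomputable def DeltaC (ρ π c c1m c1p : ℝ) (n : ℕ) : ℝ :=
  (kappaC ρ π c c1m * (c / (c - c1p)) ^ (ρ - 1) * nuC ρ c c1p ^ (ρ / (ρ - 1)) *
      Real.exp (-π / (ρ - 1))) ^ (ρ ^ n / (ρ ^ n - 1))

/-- `Θ = (η (μ/(c₁⁻-c))^{ρ-1} ξ^{ρ/(ρ-1)} e^{-π/(ρ-1)})^{ρᵐ/(ρᵐ-1)}`. -/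
noncomputable def ThetaC (ρ π c c1m c1p : ℝ) (m : ℕ) : ℝ :=
  (etaC ρ π c c1p * ((1 - c) / (c1m - c)) ^ (ρ - 1) * xiC ρ c c1m ^ (ρ / (ρ - 1)) *
      Real.exp (-π / (ρ - 1))) ^ (ρ ^ m / (ρ ^ m - 1))

/-- Slopes of chords of `φ` over `[0,1]` differ by a factor of at most `e^π`. -/
def ChordDistBound (φ : ℝ → ℝ) (π : ℝ) : Prop :=
  ∀ a b s t : ℝ, 0 ≤ a → a ≤ b → b ≤ 1 → 0 ≤ s → s ≤ t → t ≤ 1 →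
    (φ b - φ a) * (t - s) ≤ Real.exp π * (φ t - φ s) * (b - a)

theorem exists_derivWithin_eq_slope {φ : ℝ → ℝ} (h : ContDiffOn ℝ 1 φ (Icc 0 1)) {a b : ℝ}
    (ha : 0 ≤ a) (hab : a < b) (hb : b ≤ 1) :
    ∃ x ∈ Icc (0 : ℝ) 1, φ b - φ a = derivWithin φ (Icc 0 1) x * (b - a) := by
  have hsub : Icc a b ⊆ Icc (0 : ℝ) 1 := Icc_subset_Icc ha hb
  obtain ⟨x, hx, hxe⟩ := exists_hasDerivAt_eq_slope φ (derivWithin φ (Icc 0 1)) hab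
    (h.continuousOn.mono hsub) (fun x hx => by
      have hx1 : x ∈ Icc (0 : ℝ) 1 := hsub (Ioo_subset_Icc_self hx)
      have hd := (h.differentiableOn (by norm_num) x hx1).hasDerivWithinAt
      exact hd.hasDerivAt (Icc_mem_nhds (by linarith [hx.1]) (by linarith [hx.2])))
  refine ⟨x, hsub (Ioo_subset_Icc_self hx), ?_⟩
  have : b - a ≠ 0 := by linarith
  rw [hxe]
  field_simp

theorem strictMonoOn_of_derivWithin_pos_Icc {φ : ℝ → ℝ} (h : ContDiffOn ℝ 1 φ (Icc 0 1))
    (hpos : ∀ x ∈ Icc (0 : ℝ) 1, 0 < derivWithin φ (Icc 0 1) x) :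
    StrictMonoOn φ (Icc 0 1) := by
  intro a ha b hb hab
  obtain ⟨x, hx, hxe⟩ := exists_derivWithin_eq_slope h ha.1 hab hb.2
  have := mul_pos (hpos x hx) (sub_pos.2 hab)
  linarith

theorem ChordDistBound.of_distBound {φ : ℝ → ℝ} {π : ℝ} (h : ContDiffOn ℝ 1 φ (Icc 0 1))
    (hpos : ∀ x ∈ Icc (0 : ℝ) 1, 0 < derivWithin φ (Icc 0 1) x) (hd : DistBound φ π) :
    ChordDistBound φ π := by
  intro a b s t ha hab hb hs hst ht
  rcases hab.eq_or_lt with rfl | hab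
  · simp
  rcases hst.eq_or_lt with rfl | hst
  · simp
  obtain ⟨x, hx, hxe⟩ := exists_derivWithin_eq_slope h ha hab hb
  obtain ⟨y, hy, hye⟩ := exists_derivWithin_eq_slope h hs hst ht
  have hle := (Real.log_le_iff_le_exp (div_pos (hpos x hx) (hpos y hy))).1 (hd y hy x hx)
  rw [div_le_iff₀ (hpos y hy)] at hle
  rw [hxe, hye]
  have := mul_le_mul_of_nonneg_right hle (mul_pos (sub_pos.2 hab) (sub_pos.2 hst)).le
  linarith

theorem ChordDistBound.flip {φ : ℝ → ℝ} {π : ℝ} (h : ChordDistBound φ π) :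
    ChordDistBound (fun x => 1 - φ (1 - x)) π := by
  intro a b s t ha hab hb hs hst ht
  have := h (1 - b) (1 - a) (1 - t) (1 - s) (by linarith) (by linarith) (by linarith)
    (by linarith) (by linarith) (by linarith)
  ring_nf at this ⊢
  linarith

theorem StrictMonoOn.flip_Icc {φ : ℝ → ℝ} (h : StrictMonoOn φ (Icc 0 1)) :
    StrictMonoOn (fun x => 1 - φ (1 - x)) (Icc 0 1) := by
  intro a ha b hb hab
  have := h (a := 1 - b) ⟨by linarith [hb.2], by linarith [hb.1]⟩
    (b := 1 - a) ⟨by linarith [ha.2], by linarith [ha.1]⟩ (by linarith)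
  simp only
  linarith

theorem rpow_sub_rpow_le {ρ A B : ℝ} (hρ : 1 < ρ) (hA : 0 < A) (hB : 0 ≤ B) :
    A ^ ρ - B ^ ρ ≤ ρ * A ^ (ρ - 1) * (A - B) := by
  have h := one_add_mul_self_le_rpow_one_add (s := B / A - 1)
    (by linarith [div_nonneg hB hA.le]) hρ.le
  rw [show 1 + (B / A - 1) = B / A by ring, Real.div_rpow hB hA.le,
    le_div_iff₀ (Real.rpow_pos_of_pos hA ρ)] at h
  have hs : A ^ ρ = A ^ (ρ - 1) * A := by
    rw [Real.rpow_sub_one hA.ne']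
    field_simp
  have : (1 + ρ * (B / A - 1)) * A ^ ρ = A ^ ρ + ρ * A ^ (ρ - 1) * (B - A) := by
    rw [hs]
    field_simp
  linarith

/-- The expanding power law at the critical point for the right branch of a Lorenz map. -/
theorem right_branch_distance_le {ρ v c π t y : ℝ} {ψ : ℝ → ℝ} (hρ : 1 < ρ) (hv : 0 < v)
    (hv1 : v ≤ 1) (hc1 : c < 1) (hψ1 : ψ 1 = 1) (hψd : ChordDistBound ψ π)
    (hp1 : ψ (1 - v) < 1) (ht : c < t) (ht1 : t ≤ 1) (hy : ψ (1 - v) ≤ y)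
    (hty : ψ (1 + v * (-1 + ((t - c) / (1 - c)) ^ ρ)) = y) :
    nuC ρ c (ψ (1 - v)) * Real.exp (-π / ρ) * (y - ψ (1 - v)) ^ (1 / ρ) ≤ t - c := by
  have hμ : 0 < 1 - c := by linarith
  have hr0 : 0 ≤ (t - c) / (1 - c) := div_nonneg (by linarith) hμ.le
  have hr1 : (t - c) / (1 - c) ≤ 1 := (div_le_one hμ).2 (by linarith)
  set r := (t - c) / (1 - c) with hr
  have hrρ0 : 0 ≤ r ^ ρ := Real.rpow_nonneg hr0 ρ
  have hrρ1 : r ^ ρ ≤ 1 := Real.rpow_le_one hr0 hr1 (by linarith)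
  have h := hψd (1 - v) (1 + v * (-1 + r ^ ρ)) (1 - v) 1 (by linarith)
    (by nlinarith) (by nlinarith) (by linarith) (by linarith) le_rfl
  rw [hty, hψ1] at h
  have h1 : y - ψ (1 - v) ≤ Real.exp π * (1 - ψ (1 - v)) * r ^ ρ := by
    refine le_of_mul_le_mul_right ?_ hv
    calc (y - ψ (1 - v)) * v = (y - ψ (1 - v)) * (1 - (1 - v)) := by ring
      _ ≤ _ := h
      _ = _ := by ring
  set g := 1 - ψ (1 - v) with hg
  have hg0 : 0 < g := by linarith
  have h2 := Real.rpow_le_rpow (sub_nonneg.2 hy) h1 (z := 1 / ρ) (by positivity)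
  rw [Real.mul_rpow (by positivity) hrρ0, Real.mul_rpow (Real.exp_pos π).le hg0.le,
    ← Real.rpow_mul hr0, mul_one_div_cancel (by linarith : ρ ≠ 0), Real.rpow_one,
    ← Real.exp_mul] at h2
  have hg1 : 0 < g ^ (1 / ρ) := Real.rpow_pos_of_pos hg0 _
  have he : Real.exp (-π / ρ) * Real.exp (π * (1 / ρ)) = 1 := by
    rw [← Real.exp_add, show -π / ρ + π * (1 / ρ) = 0 by ring, Real.exp_zero]
  unfold nuC
  calc (1 - c) / g ^ (1 / ρ) * Real.exp (-π / ρ) * (y - ψ (1 - v)) ^ (1 / ρ)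
      ≤ (1 - c) / g ^ (1 / ρ) * Real.exp (-π / ρ) *
          (Real.exp (π * (1 / ρ)) * g ^ (1 / ρ) * r) := by gcongr
    _ = (1 - c) * r * (Real.exp (-π / ρ) * Real.exp (π * (1 / ρ))) := by field_simp
    _ = t - c := by rw [he, hr]; field_simp

theorem left_branch_distance_le {ρ u c π p z e : ℝ} {φ : ℝ → ℝ} (hρ : 1 < ρ) (hu : 0 < u)
    (hu1 : u ≤ 1) (hc : 0 < c) (hφ0 : φ 0 = 0) (hφu : 0 < φ u) (hφd : ChordDistBound φ π)
    (hz0 : 0 ≤ z) (hzp : z < p) (hpc : p < c) (hez : e ≤ z) :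
    kappaC ρ π c (φ u) * (c / (c - e)) ^ (ρ - 1) *
      (φ (u * (1 - ((c - p) / c) ^ ρ)) - φ (u * (1 - ((c - z) / c) ^ ρ))) ≤ p - z := by
  have hA0 : 0 < (c - z) / c := div_pos (by linarith) hc
  have hB0 : 0 < (c - p) / c := div_pos (by linarith) hc
  have hA1 : (c - z) / c ≤ 1 := (div_le_one hc).2 (by linarith)
  have hAB : (c - z) / c - (c - p) / c = (p - z) / c := by ring
  have hBA : (c - p) / c ≤ (c - z) / c := by gcongr
  have hAe : (c - z) / c ≤ (c - e) / c := by gcongr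
  set A := (c - z) / c
  set B := (c - p) / c
  have hAρ : A ^ ρ ≤ 1 := Real.rpow_le_one hA0.le hA1 (by linarith)
  have hBρ : 0 ≤ B ^ ρ := Real.rpow_nonneg hB0.le _
  have hBAρ : B ^ ρ ≤ A ^ ρ := Real.rpow_le_rpow hB0.le hBA (by linarith)
  have h := hφd (u * (1 - A ^ ρ)) (u * (1 - B ^ ρ)) 0 u
    (mul_nonneg hu.le (by linarith)) (by gcongr) (by nlinarith) le_rfl hu.le hu1
  rw [hφ0, sub_zero, sub_zero] at h
  have h1 : φ (u * (1 - B ^ ρ)) - φ (u * (1 - A ^ ρ)) ≤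
      Real.exp π * φ u * (A ^ ρ - B ^ ρ) := by
    refine le_of_mul_le_mul_right ?_ hu
    linarith
  have h2 := rpow_sub_rpow_le hρ hA0 hB0.le
  rw [hAB] at h2
  have h3 : A ^ (ρ - 1) ≤ ((c - e) / c) ^ (ρ - 1) :=
    Real.rpow_le_rpow hA0.le hAe (by linarith)
  have hce : 0 < c - e := by linarith
  have hG : (c / (c - e)) ^ (ρ - 1) * ((c - e) / c) ^ (ρ - 1) = 1 := by
    rw [← Real.mul_rpow (by positivity) (by positivity),
      show c / (c - e) * ((c - e) / c) = 1 by field_simp, Real.one_rpow]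
  have hE : Real.exp (-π) * Real.exp π = 1 := by
    rw [← Real.exp_add, neg_add_cancel, Real.exp_zero]
  have hd : 0 < p - z := by linarith
  unfold kappaC
  have hρ0 : 0 < ρ := by linarith
  calc Real.exp (-π) * c / (φ u * ρ) * (c / (c - e)) ^ (ρ - 1) *
        (φ (u * (1 - B ^ ρ)) - φ (u * (1 - A ^ ρ)))
      ≤ Real.exp (-π) * c / (φ u * ρ) * (c / (c - e)) ^ (ρ - 1) *
        (Real.exp π * φ u * (ρ * ((c - e) / c) ^ (ρ - 1) * ((p - z) / c))) := by
        refine mul_le_mul_of_nonneg_left (h1.trans ?_) (by positivity)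
        refine mul_le_mul_of_nonneg_left (h2.trans ?_) (by positivity)
        gcongr
    _ = (Real.exp (-π) * Real.exp π) *
        ((c / (c - e)) ^ (ρ - 1) * ((c - e) / c) ^ (ρ - 1)) * (p - z) := by
        field_simp
    _ = p - z := by rw [hE, hG]; ring

/-- Solving `K N^{1-ρ⁻ⁿ} d^{ρ⁻ⁿ} ≤ d` for `d`, when `N ≤ 1`. -/
theorem rpow_le_of_mul_rpow_le {ρ K N d : ℝ} {n : ℕ} (hρ : 1 < ρ) (hn : 1 ≤ n) (hK : 0 ≤ K)
    (hN : 0 < N) (hN1 : N ≤ 1) (hd : 0 < d)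
    (h : K * (N ^ (1 - (ρ ^ n)⁻¹) * d ^ (ρ ^ n)⁻¹) ≤ d) :
    (K * N) ^ (ρ ^ n / (ρ ^ n - 1)) ≤ d := by
  have hr : 1 < ρ ^ n := one_lt_pow₀ hρ (by lia)
  set r := ρ ^ n
  have hr0 : 0 < r⁻¹ := by positivity
  have hr1 : r⁻¹ < 1 := inv_lt_one_of_one_lt₀ hr
  have hNle : N ≤ N ^ (1 - r⁻¹) := by
    simpa using Real.rpow_le_rpow_of_exponent_ge hN hN1 (by linarith : 1 - r⁻¹ ≤ 1)
  have h1 : K * N ≤ d ^ (1 - r⁻¹) := by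
    rw [Real.rpow_sub hd, Real.rpow_one, le_div_iff₀ (Real.rpow_pos_of_pos hd _)]
    refine le_trans ?_ h
    rw [mul_assoc]
    gcongr
  have hexp : 0 ≤ r / (r - 1) := div_nonneg (by linarith) (by linarith)
  calc (K * N) ^ (r / (r - 1)) ≤ (d ^ (1 - r⁻¹)) ^ (r / (r - 1)) :=
        Real.rpow_le_rpow (by positivity) h1 hexp
    _ = d := by
        have hne : r - 1 ≠ 0 := by linarith
        rw [← Real.rpow_mul hd.le, show (1 - r⁻¹) * (r / (r - 1)) = 1 by field_simp,
          Real.rpow_one]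

/-- The lower bound for `p - f₀⁻¹(c)`, in terms of the orbit `x 0 = p, …, x n = f p` of `p`
under the inverse of the right branch. -/
theorem deltaC_le_sub {ρ u v c π p z : ℝ} {φ ψ : ℝ → ℝ} {n : ℕ} {x : ℕ → ℝ}
    (hρ : 1 < ρ) (hu : 0 < u) (hu1 : u ≤ 1) (hv : 0 < v) (hv1 : v ≤ 1) (hc : 0 < c) (hc1 : c < 1)
    (hφ0 : φ 0 = 0) (hψ0 : ψ 0 = 0) (hψ1 : ψ 1 = 1) (hφm : StrictMonoOn φ (Icc 0 1))
    (hψm : StrictMonoOn ψ (Icc 0 1)) (hπ : 0 < π) (hφd : ChordDistBound φ π)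
    (hψd : ChordDistBound ψ π) (hn : 1 ≤ n) (hz0 : 0 ≤ z) (hzp : z < p) (hpc : p < c)
    (hez : ψ (1 - v) < z) (hz : φ (u * (1 - ((c - z) / c) ^ ρ)) = c) (hx0 : x 0 = p)
    (hxn : φ (u * (1 - ((c - p) / c) ^ ρ)) = x n)
    (hxc : ∀ k < n, c < x (k + 1) ∧ x (k + 1) ≤ 1)
    (hx : ∀ k < n, ψ (1 + v * (-1 + ((x (k + 1) - c) / (1 - c)) ^ ρ)) = x k) :
    DeltaC ρ π c (φ u) (ψ (1 - v)) n ≤ p - z := by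
  have hρ0 : 0 < ρ := by linarith
  have hρ1 : 0 < ρ - 1 := by linarith
  have hd : 0 < p - z := by linarith
  have he0 : 0 ≤ ψ (1 - v) := by
    rw [← hψ0]
    exact hψm.monotoneOn ⟨le_rfl, zero_le_one⟩ ⟨by linarith, by linarith⟩ (by linarith)
  have hφu : 0 < φ u := by
    rw [← hφ0]
    exact hφm ⟨le_rfl, zero_le_one⟩ ⟨hu.le, hu1⟩ hu
  have hν0 : 0 < nuC ρ c (ψ (1 - v)) :=
    div_pos (by linarith) (Real.rpow_pos_of_pos (by linarith) _)
  have hν1 : nuC ρ c (ψ (1 - v)) ≤ 1 := by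
    refine (div_le_one (Real.rpow_pos_of_pos (by linarith) _)).2 ?_
    have := Real.rpow_le_rpow_of_exponent_ge (x := 1 - ψ (1 - v)) (by linarith) (by linarith)
      ((div_le_one hρ0).2 hρ.le)
    rw [Real.rpow_one] at this
    linarith
  set ν := nuC ρ c (ψ (1 - v)) with hν
  set N := ν ^ (ρ / (ρ - 1)) * Real.exp (-π / (ρ - 1)) with hN
  have hN0 : 0 < N := by positivity
  have hN1 : N ≤ 1 := by
    refine mul_le_one₀ (Real.rpow_le_one hν0.le hν1 (by positivity)) (Real.exp_pos _).le ?_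
    rw [Real.exp_le_one_iff]
    exact div_nonpos_of_nonpos_of_nonneg (by linarith) hρ1.le
  have hS : ν * Real.exp (-π / ρ) = N ^ ((ρ - 1) / ρ) := by
    rw [hN, Real.mul_rpow (by positivity) (Real.exp_pos _).le, ← Real.rpow_mul hν0.le,
      ← Real.exp_mul, show ρ / (ρ - 1) * ((ρ - 1) / ρ) = 1 by field_simp, Real.rpow_one,
      show -π / (ρ - 1) * ((ρ - 1) / ρ) = -π / ρ by field_simp]
  have hstep : ∀ k < n,
      N ^ (1 - (ρ ^ k)⁻¹) * (p - z) ^ (ρ ^ k)⁻¹ ≤ x k - ψ (1 - v) →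
      N ^ (1 - (ρ ^ (k + 1))⁻¹) * (p - z) ^ (ρ ^ (k + 1))⁻¹ ≤ x (k + 1) - c := by
    intro k hk h
    have hpos : 0 < N ^ (1 - (ρ ^ k)⁻¹) * (p - z) ^ (ρ ^ k)⁻¹ := by positivity
    refine le_trans ?_ (right_branch_distance_le hρ hv hv1 hc1 hψ1 hψd (by linarith)
      (hxc k hk).1 (hxc k hk).2 (by linarith) (hx k hk))
    rw [← hν, hS]
    refine le_trans (le_of_eq ?_) (mul_le_mul_of_nonneg_left
      (Real.rpow_le_rpow hpos.le h (by positivity : 0 ≤ 1 / ρ)) (by positivity))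
    rw [Real.mul_rpow (x := N ^ (1 - (ρ ^ k)⁻¹)) (by positivity) (by positivity),
      ← Real.rpow_mul hN0.le,
      ← Real.rpow_mul hd.le, ← mul_assoc, ← Real.rpow_add hN0]
    congr 2
    · field_simp
      ring
    · rw [pow_succ, mul_inv, one_div]
  have hall : ∀ k ≤ n, N ^ (1 - (ρ ^ k)⁻¹) * (p - z) ^ (ρ ^ k)⁻¹ ≤ x k - ψ (1 - v) := by
    intro k
    induction k with
    | zero =>
      intro _
      simp only [pow_zero, inv_one, sub_self, Real.rpow_zero, Real.rpow_one, one_mul, hx0]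
      linarith
    | succ k ih =>
      intro hk
      linarith [hstep k (by lia) (ih (by lia))]
  obtain ⟨j, rfl⟩ : ∃ j, n = j + 1 := ⟨n - 1, by lia⟩
  have hlow := hstep j (by lia) (hall j (by lia))
  have hup := left_branch_distance_le hρ hu hu1 hc hφ0 hφu hφd hz0 hzp hpc hez.le
  rw [hxn, hz] at hup
  have hK : 0 ≤ kappaC ρ π c (φ u) * (c / (c - ψ (1 - v))) ^ (ρ - 1) := by
    have : 0 < c - ψ (1 - v) := by linarith
    unfold kappaC
    positivity
  have := rpow_le_of_mul_rpow_le hρ hn hK hN0 hN1 hd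
    ((mul_le_mul_of_nonneg_left hlow hK).trans hup)
  unfold DeltaC
  rwa [mul_assoc (kappaC ρ π c (φ u) * _)]

theorem thetaC_eq_deltaC (ρ π c a b : ℝ) (m : ℕ) :
    ThetaC ρ π c a b m = DeltaC ρ π (1 - c) (1 - b) (1 - a) m := by
  unfold ThetaC DeltaC etaC kappaC xiC nuC
  rw [show 1 - c - (1 - a) = a - c by ring, sub_sub_cancel, sub_sub_cancel]

theorem lorenzF_of_lt {ρ u v c : ℝ} {φ ψ : ℝ → ℝ} {x : ℝ} (h : x < c) :
    lorenzF ρ u v c φ ψ x = φ (u * (1 - ((c - x) / c) ^ ρ)) := if_pos h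

theorem lorenzF_of_le {ρ u v c : ℝ} {φ ψ : ℝ → ℝ} {x : ℝ} (h : c ≤ x) :
    lorenzF ρ u v c φ ψ x = ψ (1 + v * (-1 + ((x - c) / (1 - c)) ^ ρ)) := if_neg h.not_gt

theorem mem_Icc_left_branch {ρ u c x : ℝ} (hρ : 1 < ρ) (hu : 0 < u) (hu1 : u ≤ 1) (hc : 0 < c)
    (hx0 : 0 ≤ x) (hxc : x ≤ c) : u * (1 - ((c - x) / c) ^ ρ) ∈ Icc (0 : ℝ) 1 := by
  have h0 : 0 ≤ (c - x) / c := div_nonneg (by linarith) hc.le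
  have h1 := Real.rpow_le_one h0 ((div_le_one hc).2 (by linarith)) (by linarith : 0 ≤ ρ)
  have h2 := Real.rpow_nonneg h0 ρ
  exact ⟨mul_nonneg hu.le (by linarith), by nlinarith⟩

theorem strictMonoOn_left_branch {ρ u c : ℝ} {φ : ℝ → ℝ} (hρ : 1 < ρ) (hu : 0 < u)
    (hu1 : u ≤ 1) (hc : 0 < c) (hφm : StrictMonoOn φ (Icc 0 1)) :
    StrictMonoOn (fun x => φ (u * (1 - ((c - x) / c) ^ ρ))) (Icc 0 c) := by
  intro a ha b hb hab
  refine hφm (mem_Icc_left_branch hρ hu hu1 hc ha.1 ha.2)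
    (mem_Icc_left_branch hρ hu hu1 hc hb.1 hb.2) ?_
  have : ((c - b) / c) ^ ρ < ((c - a) / c) ^ ρ :=
    Real.rpow_lt_rpow (div_nonneg (by linarith [hb.2]) hc.le) (by gcongr) (by linarith)
  gcongr

theorem one_sub_left_branch_flip (ρ v c y : ℝ) :
    1 - v * (1 - ((1 - c - (1 - y)) / (1 - c)) ^ ρ) =
      1 + v * (-1 + ((y - c) / (1 - c)) ^ ρ) := by
  rw [show 1 - c - (1 - y) = y - c by ring]
  ring

theorem strictMonoOn_right_branch {ρ v c : ℝ} {ψ : ℝ → ℝ} (hρ : 1 < ρ) (hv : 0 < v)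
    (hv1 : v ≤ 1) (hc1 : c < 1) (hψm : StrictMonoOn ψ (Icc 0 1)) :
    StrictMonoOn (fun x => ψ (1 + v * (-1 + ((x - c) / (1 - c)) ^ ρ))) (Icc c 1) := by
  intro a ha b hb hab
  have h := strictMonoOn_left_branch (c := 1 - c) hρ hv hv1 (by linarith) hψm.flip_Icc
    (a := 1 - b) ⟨by linarith [hb.2], by linarith [hb.1]⟩
    (b := 1 - a) ⟨by linarith [ha.2], by linarith [ha.1]⟩ (by linarith)
  simp only [one_sub_left_branch_flip] at h ⊢
  linarith

/-- For a Lorenz map in `K^π` renormalizable of monotone type `(0 1ⁿ, 1 0ᵐ)`: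
`|p - f₀⁻¹(c)| ≥ Δ` and `|q - f₁⁻¹(c)| ≥ Θ`. -/
theorem preimage_distance_lower_bounds (ρ u v c π : ℝ) (φ ψ : ℝ → ℝ)
    (n m : ℕ) (p q : ℝ)
    (hL : IsLorenz 1 ρ u v c φ ψ) (hπ : 0 < π)
    (hφd : DistBound φ π) (hψd : DistBound ψ π)
    (hren : MonotoneRenorm ρ u v c φ ψ n m p q) :
    (∀ z : ℝ, 0 ≤ z → z < c → lorenzF ρ u v c φ ψ z = c →
      DeltaC ρ π c (φ u) (ψ (1 - v)) n ≤ |p - z|) ∧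
    (∀ w : ℝ, c < w → w ≤ 1 → lorenzF ρ u v c φ ψ w = c →
      ThetaC ρ π c (φ u) (ψ (1 - v)) m ≤ |q - w|) := by
  obtain ⟨hρ, hu, hu1, hv, hv1, hc, hc1, hφs, hψs, hφ0, hφ1, hψ0, hψ1, hφp, hψp⟩ := hL
  have hφm := strictMonoOn_of_derivWithin_pos_Icc (by exact_mod_cast hφs) hφp
  have hψm := strictMonoOn_of_derivWithin_pos_Icc (by exact_mod_cast hψs) hψp
  have hφc := ChordDistBound.of_distBound (by exact_mod_cast hφs) hφp hφd
  have hψc := ChordDistBound.of_distBound (by exact_mod_cast hψs) hψp hψd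
  have hleft := strictMonoOn_left_branch hρ hu hu1 hc hφm
  have hright := strictMonoOn_right_branch hρ hv hv1 hc1 hψm
  obtain ⟨hn, hm, hp0, hpc, hcq, hq1, -, hpfix, -, hqfix, hLi, hRi, hnl, hnr⟩ := hren
  set f := lorenzF ρ u v c φ ψ with hf
  have hpk : ∀ k, 1 ≤ k → k ≤ n → c < f^[k] p ∧ f^[k] p ≤ 1 := fun k h1 h2 =>
    (hLi k h1 h2).1 ⟨p, ⟨le_rfl, hpc⟩, rfl⟩
  have hqk : ∀ k, 1 ≤ k → k ≤ m → 0 ≤ f^[k] q ∧ f^[k] q < c := fun k h1 h2 =>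
    (hRi k h1 h2).1 ⟨q, ⟨hcq, le_rfl⟩, rfl⟩
  have hfp := hpk 1 le_rfl hn
  have hfq := hqk 1 le_rfl hm
  simp only [Function.iterate_one] at hfp hfq
  have hfpe : f p = φ (u * (1 - ((c - p) / c) ^ ρ)) := lorenzF_of_lt hpc
  have hfqe : f q = ψ (1 + v * (-1 + ((q - c) / (1 - c)) ^ ρ)) := lorenzF_of_le hcq.le
  have hρ0 : ρ ≠ 0 := by linarith
  have hcm : f p < φ u := by
    have h := hleft ⟨hp0.le, hpc.le⟩ ⟨hc.le, le_rfl⟩ hpc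
    simpa [Real.zero_rpow hρ0, ← hfpe] using h
  have hcp : ψ (1 - v) < f q := by
    have h := hright ⟨le_rfl, hc1.le⟩ ⟨hcq.le, hq1.le⟩ hcq
    simpa [Real.zero_rpow hρ0, ← hfqe, ← sub_eq_add_neg] using h
  have hleft_le : ∀ a b, 0 ≤ a → a ≤ b → b < c → f a ≤ f b := fun a b ha hab hb => by
    rw [hf, lorenzF_of_lt hb, lorenzF_of_lt (hab.trans_lt hb)]
    exact hleft.monotoneOn ⟨ha, (hab.trans_lt hb).le⟩ ⟨ha.trans hab, hb.le⟩ hab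
  have hright_le : ∀ a b, c < a → a ≤ b → b ≤ 1 → f a ≤ f b := fun a b ha hab hb => by
    rw [hf, lorenzF_of_le ha.le, lorenzF_of_le (ha.le.trans hab)]
    exact hright.monotoneOn ⟨ha.le, hab.trans hb⟩ ⟨ha.le.trans hab, hb⟩ hab
  constructor
  · intro z hz0 hzc hfz
    have hzp : z < p := by
      by_contra! h
      linarith [hleft_le p z hp0.le h hzc]
    have hez : ψ (1 - v) < z := by
      by_contra! h
      rcases hm.eq_or_lt with rfl | hm2
      · rw [Function.iterate_one] at hnr
        linarith [hleft_le z _ hz0 h (by linarith)]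
      · have h2 := hqk 2 (by lia) hm2
        simp only [Function.iterate_succ, Function.iterate_zero, Function.comp, id] at h2
        linarith [hleft_le z (f q) hz0 (by linarith) hfq.2]
    rw [abs_of_pos (by linarith)]
    rw [hf, lorenzF_of_lt hzc] at hfz
    refine deltaC_le_sub (x := fun k => f^[n + 1 - k] p) hρ hu hu1 hv hv1 hc hc1 hφ0 hψ0 hψ1
      hφm hψm hπ hφc hψc hn hz0 hzp hpc hez hfz hpfix ?_ ?_ ?_
    · simp [hfpe]
    · exact fun k hk => hpk (n + 1 - (k + 1)) (by lia) (by lia)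
    · intro k hk
      have h1 := hpk (n + 1 - (k + 1)) (by lia) (by lia)
      rw [← lorenzF_of_le (ρ := ρ) (φ := φ) (ψ := ψ) (u := u) (v := v) h1.1.le,
        ← hf, ← Function.iterate_succ_apply' f]
      congr 2
      lia
  · intro w hcw hw1 hfw
    have hqw : q < w := by
      by_contra! h
      linarith [hright_le w q hcw h hq1.le]
    have hwe : w < φ u := by
      by_contra! h
      rcases hn.eq_or_lt with rfl | hn2
      · rw [Function.iterate_one] at hnl
        linarith [hright_le _ w (by linarith) h hw1]
      · have h2 := hpk 2 (by lia) hn2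
        simp only [Function.iterate_succ, Function.iterate_zero, Function.comp, id] at h2
        linarith [hright_le (f p) w hfp.1 (by linarith) hw1]
    rw [abs_of_neg (by linarith), thetaC_eq_deltaC]
    rw [hf, lorenzF_of_le hcw.le] at hfw
    have hLe : ∀ y : ℝ, 1 - (1 + u * (-1 + ((1 - y - (1 - c)) / (1 - (1 - c))) ^ ρ)) =
        u * (1 - ((c - y) / c) ^ ρ) := fun y => by
      rw [show 1 - y - (1 - c) = c - y by ring, sub_sub_cancel]
      ring
    have key := deltaC_le_sub (x := fun k => 1 - f^[m + 1 - k] q) (c := 1 - c) (n := m)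
      (p := 1 - q) (z := 1 - w) hρ hv hv1 hu hu1 (by linarith) (by linarith) (by simp [hψ1])
      (by simp [hφ1]) (by simp [hφ0]) hψm.flip_Icc hφm.flip_Icc hπ hψc.flip hφc.flip hm
      (by linarith) (by linarith) (by linarith) (by simpa using hwe)
      (by simp only [one_sub_left_branch_flip, hfw]) (by simp [hqfix]) 
      (by simp only [one_sub_left_branch_flip, ← hfqe, add_tsub_cancel_left,
        Function.iterate_one])
      (fun k hk => by
        have := hqk (m + 1 - (k + 1)) (by lia) (by lia)
        constructor <;> linarith [this.1, this.2])
      (fun k hk => by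
        have h1 := hqk (m + 1 - (k + 1)) (by lia) (by lia)
        simp only [hLe]
        rw [← lorenzF_of_lt (ρ := ρ) (φ := φ) (ψ := ψ) (u := u) (v := v) h1.2,
          ← hf, ← Function.iterate_succ_apply' f]
        congr 3
        lia)
    rw [sub_sub_cancel] at key
    linarith
end

section
/- Let π>0 and let f ∈ K^π be a C^1 Lorenz map that is renormalizable of monotone combinatorial type (0 1^n, 1 0^m). Then the critical values satisfy c_1^+ ≥ κ^m·Δ/(1 − κ^m) and 1 − c_1^− ≥ η^n·Θ/(1 − η^n). -/
open Set

/-- Two difference quotients of a diffeomorphism with distortion at most `π` differ by a factor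
of at most `exp π`. -/
lemma DistBound.sub_mul_sub_le {φ : ℝ → ℝ} {π : ℝ} (hd : DistBound φ π)
    (hs : ContDiffOn ℝ 1 φ (Icc 0 1))
    (hpos : ∀ x ∈ Icc (0:ℝ) 1, 0 < derivWithin φ (Icc 0 1) x)
    {s t s' t' : ℝ} (h0 : 0 ≤ s) (hst : s ≤ t) (h1 : t ≤ 1)
    (h0' : 0 ≤ s') (hst' : s' ≤ t') (h1' : t' ≤ 1) :
    (φ t - φ s) * (t' - s') ≤ Real.exp π * (φ t' - φ s') * (t - s) := by
  rcases hst.eq_or_lt with rfl | hst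
  · simp
  rcases hst'.eq_or_lt with rfl | hst'
  · simp
  have slope : ∀ a b : ℝ, 0 ≤ a → a < b → b ≤ 1 →
      ∃ x ∈ Icc (0:ℝ) 1, φ b - φ a = derivWithin φ (Icc 0 1) x * (b - a) := by
    intro a b ha hab hb
    have hsub : Icc a b ⊆ Icc 0 1 := Icc_subset_Icc ha hb
    have hdiff := hs.differentiableOn (by norm_num)
    obtain ⟨x, hx, hxe⟩ := exists_hasDerivAt_eq_slope φ (fun x => derivWithin φ (Icc 0 1) x) hab
      (hs.continuousOn.mono hsub) (fun x hx => by
        have hx1 : x ∈ Icc (0:ℝ) 1 := hsub (Ioo_subset_Icc_self hx)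
        exact (hdiff x hx1).hasDerivWithinAt.hasDerivAt
          (Icc_mem_nhds (ha.trans_lt hx.1) (hx.2.trans_le hb)))
    refine ⟨x, hsub (Ioo_subset_Icc_self hx), ?_⟩
    have : b - a ≠ 0 := by linarith
    rw [hxe]
    field_simp
  obtain ⟨x, hx, hxe⟩ := slope s t h0 hst h1
  obtain ⟨y, hy, hye⟩ := slope s' t' h0' hst' h1'
  have hle := hd y hy x hx
  rw [Real.log_le_iff_le_exp (div_pos (hpos x hx) (hpos y hy)), div_le_iff₀ (hpos y hy)] at hle
  rw [hxe, hye]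
  have h := mul_le_mul_of_nonneg_right hle
    (mul_nonneg (sub_nonneg.2 hst.le) (sub_nonneg.2 hst'.le))
  linarith

lemma strictMonoOn_of_derivWithin_Icc_pos {φ : ℝ → ℝ} (hs : ContDiffOn ℝ 1 φ (Icc 0 1))
    (hpos : ∀ x ∈ Icc (0:ℝ) 1, 0 < derivWithin φ (Icc 0 1) x) : StrictMonoOn φ (Icc 0 1) := by
  refine strictMonoOn_of_deriv_pos (convex_Icc 0 1) hs.continuousOn fun x hx => ?_
  rw [interior_Icc] at hx
  rw [← derivWithin_of_mem_nhds (Icc_mem_nhds hx.1 hx.2)]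
  exact hpos x (Ioo_subset_Icc_self hx)

/-- The tangent line inequality for `x ↦ x ^ ρ`. -/
lemma rpow_sub_rpow_le_s9 {ρ s t : ℝ} (hρ : 1 < ρ) (ht : 0 ≤ t) (hts : t ≤ s) :
    s ^ ρ - t ^ ρ ≤ ρ * s ^ (ρ - 1) * (s - t) := by
  rcases (ht.trans hts).eq_or_lt with rfl | hs
  · have : t = 0 := le_antisymm hts ht
    simp [this]
  have hb := one_add_mul_self_le_rpow_one_add (s := t / s - 1) (p := ρ)
    (by linarith [div_nonneg ht hs.le]) hρ.le
  rw [add_sub_cancel, Real.div_rpow ht hs.le, le_div_iff₀ (Real.rpow_pos_of_pos hs ρ)] at hb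
  have he : s ^ ρ = s ^ (ρ - 1) * s := by
    rw [← Real.rpow_add_one hs.ne', sub_add_cancel]
  have hr : (1 + ρ * (t / s - 1)) * s ^ ρ = s ^ ρ - ρ * s ^ (ρ - 1) * (s - t) := by
    rw [he]; field_simp; ring
  linarith

/-- If `t ≤ (t / g) ^ N` for some `N > 1`, then `t ≥ g ^ (N / (N - 1))`. -/
lemma rpow_le_of_le_div_rpow {t g N : ℝ} (ht : 0 < t) (hg : 0 < g) (hN : 1 < N)
    (h : t ≤ (t / g) ^ N) : g ^ (N / (N - 1)) ≤ t := by
  have hN1 : 0 < N - 1 := by linarith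
  rw [Real.div_rpow ht.le hg.le, le_div_iff₀ (Real.rpow_pos_of_pos hg N)] at h
  have he : t ^ N = t * t ^ (N - 1) := by
    rw [mul_comm, ← Real.rpow_add_one ht.ne', sub_add_cancel]
  rw [he] at h
  have h2 : g ^ N ≤ t ^ (N - 1) := le_of_mul_le_mul_left h ht
  have h3 := Real.rpow_le_rpow (Real.rpow_nonneg hg.le N) h2 (inv_nonneg.2 hN1.le)
  rwa [← Real.rpow_mul hg.le, ← Real.rpow_mul ht.le, mul_inv_cancel₀ hN1.ne', Real.rpow_one,
    ← div_eq_mul_inv] at h3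

/-- Iterating `z (k + 1) - b ≤ A * ((z k - c) / A) ^ ρ`. -/
lemma sub_div_le_rpow_pow {ρ A b c : ℝ} {n : ℕ} {z : ℕ → ℝ} (hρ : 0 ≤ ρ) (hA : 0 < A)
    (hbc : b ≤ c) (hz : ∀ k < n, c ≤ z k)
    (hstep : ∀ k < n, (z (k + 1) - b) / A ≤ ((z k - c) / A) ^ ρ) :
    ∀ k < n, (z (k + 1) - b) / A ≤ ((z 0 - c) / A) ^ (ρ ^ (k + 1)) := by
  intro k
  induction k with
  | zero => intro hk; simpa using hstep 0 hk
  | succ k ih =>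
    intro hk
    have h0 : 0 ≤ (z 0 - c) / A := div_nonneg (sub_nonneg.2 (hz 0 (by omega))) hA.le
    have hk0 : 0 ≤ (z (k + 1) - c) / A := div_nonneg (sub_nonneg.2 (hz _ hk)) hA.le
    refine (hstep _ hk).trans ?_
    rw [pow_succ ρ (k + 1), Real.rpow_mul h0]
    refine Real.rpow_le_rpow hk0 (le_trans ?_ (ih (by omega))) hρ
    gcongr

/-- Lower bound for a critical value `b`, from `b ≥ κ ^ m * p` and the backward orbit `z` of the
periodic point `p`, which forces `p - b ≥ Δ`. -/
lemma lower_bound_of_orbit {ρ π c a b p : ℝ} {n m : ℕ} {z : ℕ → ℝ} (hρ : 1 < ρ) (hπ : 0 < π)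
    (hc0 : 0 < c) (hc1 : c < 1) (hca : c < a) (hb : 0 ≤ b) (hbp : b < p) (hpc : p < c)
    (hn : 1 ≤ n) (hm : 1 ≤ m) (hz : ∀ k < n, c ≤ z k)
    (hstep : ∀ k < n, z (k + 1) - b ≤ Real.exp π * (1 - b) * ((z k - c) / (1 - c)) ^ ρ)
    (hzn : z n = p)
    (hz0 : z 0 - c ≤ (p - b) * ((c - b) / c) ^ (ρ - 1) / kappaC ρ π c a)
    (hpm : kappaC ρ π c a ^ m * p ≤ b) :
    kappaC ρ π c a ^ m * DeltaC ρ π c a b n / (1 - kappaC ρ π c a ^ m) ≤ b := by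
  have hρ1 : 0 < ρ - 1 := by linarith
  have hμ : 0 < 1 - c := by linarith
  have hb1 : 0 < 1 - b := by linarith
  have hcb : 0 < c - b := by linarith
  have hκ : 0 < kappaC ρ π c a := by
    unfold kappaC
    have : 0 < a := by linarith
    positivity
  have hκ1 : kappaC ρ π c a < 1 := by
    have ha : 0 < a := by linarith
    unfold kappaC
    rw [div_lt_one (by positivity)]
    have h1 : Real.exp (-π) < 1 := Real.exp_lt_one_iff.2 (by linarith)
    nlinarith [Real.exp_pos (-π)]
  have hκm : kappaC ρ π c a ^ m < 1 := pow_lt_one₀ hκ.le hκ1 (by omega)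
  have hκm0 : 0 < kappaC ρ π c a ^ m := pow_pos hκ m
  have hν : 0 < nuC ρ c b := by unfold nuC; positivity
  have hν1 : nuC ρ c b ≤ 1 := by
    unfold nuC
    rw [div_le_one (by positivity)]
    have h1 : 1 - b ≤ (1 - b) ^ (1 / ρ) := by
      conv_lhs => rw [← Real.rpow_one (1 - b)]
      exact Real.rpow_le_rpow_of_exponent_ge hb1 (by linarith)
        ((div_le_one (by linarith)).2 hρ.le)
    linarith
  set A := nuC ρ c b ^ (ρ / (ρ - 1)) * Real.exp (-π / (ρ - 1)) with hAdef
  have hA : 0 < A := by positivity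
  have hA1 : A ≤ 1 := by
    have h1 : nuC ρ c b ^ (ρ / (ρ - 1)) ≤ 1 := Real.rpow_le_one hν.le hν1 (by positivity)
    have h2 : Real.exp (-π / (ρ - 1)) ≤ 1 :=
      Real.exp_le_one_iff.2 (div_nonpos_of_nonpos_of_nonneg (by linarith) hρ1.le)
    exact mul_le_one₀ h1 (Real.exp_pos _).le h2
  have hApow : A ^ (ρ - 1) = (1 - c) ^ ρ / (1 - b) * Real.exp (-π) := by
    rw [hAdef, Real.mul_rpow (by positivity) (by positivity), ← Real.rpow_mul hν.le,
      ← Real.exp_mul, div_mul_cancel₀ _ hρ1.ne', div_mul_cancel₀ _ hρ1.ne']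
    congr 1
    unfold nuC
    rw [Real.div_rpow hμ.le (by positivity), ← Real.rpow_mul hb1.le, one_div,
      inv_mul_cancel₀ (by linarith), Real.rpow_one]
  have hAρ : A ^ ρ = A * A ^ (ρ - 1) := by
    rw [mul_comm, ← Real.rpow_add_one hA.ne', sub_add_cancel]
  have hstep' : ∀ k < n, (z (k + 1) - b) / A ≤ ((z k - c) / A) ^ ρ := by
    intro k hk
    have hzk : 0 ≤ z k - c := sub_nonneg.2 (hz k hk)
    have h := hstep k hk
    rw [Real.div_rpow hzk hμ.le] at h
    rw [Real.div_rpow hzk hA.le, hAρ, hApow, div_le_iff₀ hA]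
    refine h.trans (le_of_eq ?_)
    rw [Real.exp_neg]
    field_simp
  obtain ⟨k, rfl⟩ : ∃ k, n = k + 1 := ⟨n - 1, by omega⟩
  have hiter := sub_div_le_rpow_pow (by linarith) hA (by linarith) hz hstep' k (by omega)
  rw [hzn] at hiter
  have hd : 0 < p - b := by linarith
  set g := kappaC ρ π c a * (c / (c - b)) ^ (ρ - 1) with hg
  have hg0 : 0 < g := by positivity
  have hN : 1 < ρ ^ (k + 1) := one_lt_pow₀ hρ (by omega)
  have hz0' : (z 0 - c) / A ≤ (p - b) / A / g := by
    have : (p - b) / A / g = (p - b) * ((c - b) / c) ^ (ρ - 1) / kappaC ρ π c a / A := by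
      rw [hg, Real.div_rpow hc0.le hcb.le, Real.div_rpow hcb.le hc0.le]
      field_simp
    rw [this]
    gcongr
  have hfix : (p - b) / A ≤ ((p - b) / A / g) ^ (ρ ^ (k + 1)) :=
    hiter.trans (Real.rpow_le_rpow (div_nonneg (sub_nonneg.2 (hz 0 (by omega))) hA.le) hz0'
      (by positivity))
  have hmain := rpow_le_of_le_div_rpow (div_pos hd hA) hg0 hN hfix
  rw [le_div_iff₀ hA] at hmain
  have hΔ : DeltaC ρ π c a b (k + 1) ≤ p - b := by
    have hD : DeltaC ρ π c a b (k + 1) =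
        g ^ (ρ ^ (k + 1) / (ρ ^ (k + 1) - 1)) * A ^ (ρ ^ (k + 1) / (ρ ^ (k + 1) - 1)) := by
      rw [← Real.mul_rpow hg0.le hA.le, hg, hAdef, DeltaC, ← mul_assoc]
    rw [hD]
    refine le_trans ?_ hmain
    gcongr
    conv_rhs => rw [← Real.rpow_one A]
    refine Real.rpow_le_rpow_of_exponent_ge hA hA1 ?_
    rw [le_div_iff₀ (by linarith)]
    linarith
  rw [div_le_iff₀ (by linarith)]
  nlinarith [mul_le_mul_of_nonneg_left hΔ hκm0.le]

/-- Backward iteration of `x (k + 1) ≤ x k / κ`. -/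
lemma pow_mul_le_of_le_div {κ : ℝ} (hκ : 0 < κ) {m : ℕ} {x : ℕ → ℝ}
    (h : ∀ k < m, x (k + 1) ≤ x k / κ) : κ ^ m * x m ≤ x 0 := by
  induction m with
  | zero => simp
  | succ m ih =>
    refine le_trans ?_ (ih fun k hk => h k (by omega))
    have := h m (by omega)
    rw [le_div_iff₀ hκ] at this
    rw [pow_succ, mul_assoc]
    gcongr
    linarith

section Branches

variable {ρ u v c π : ℝ} {φ ψ : ℝ → ℝ}

lemma IsLorenz.left_arg_mem (hL : IsLorenz 1 ρ u v c φ ψ) {x : ℝ} (h0 : 0 ≤ x) (hc : x ≤ c) :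
    u * (1 - ((c - x) / c) ^ ρ) ∈ Icc 0 u := by
  have hc0 := hL.c_pos
  have h1 : 0 ≤ ((c - x) / c) ^ ρ := Real.rpow_nonneg (div_nonneg (by linarith) hc0.le) _
  have h2 : ((c - x) / c) ^ ρ ≤ 1 :=
    Real.rpow_le_one (div_nonneg (by linarith) hc0.le) ((div_le_one hc0).2 (by linarith))
      (by linarith [hL.one_lt_rho])
  constructor <;> nlinarith [hL.u_pos]

lemma IsLorenz.right_arg_mem (hL : IsLorenz 1 ρ u v c φ ψ) {x : ℝ} (hc : c ≤ x) (h1 : x ≤ 1) :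
    1 + v * (-1 + ((x - c) / (1 - c)) ^ ρ) ∈ Icc (1 - v) 1 := by
  have hc1 : 0 < 1 - c := by linarith [hL.c_lt_one]
  have h1 : 0 ≤ ((x - c) / (1 - c)) ^ ρ := Real.rpow_nonneg (div_nonneg (by linarith) hc1.le) _
  have h2 : ((x - c) / (1 - c)) ^ ρ ≤ 1 :=
    Real.rpow_le_one (div_nonneg (by linarith) hc1.le) ((div_le_one hc1).2 (by linarith))
      (by linarith [hL.one_lt_rho])
  constructor <;> nlinarith [hL.v_pos]

lemma IsLorenz.phi_strictMonoOn (hL : IsLorenz 1 ρ u v c φ ψ) : StrictMonoOn φ (Icc 0 1) :=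
  strictMonoOn_of_derivWithin_Icc_pos hL.phi_smooth hL.phi_deriv_pos

lemma IsLorenz.psi_strictMonoOn (hL : IsLorenz 1 ρ u v c φ ψ) : StrictMonoOn ψ (Icc 0 1) :=
  strictMonoOn_of_derivWithin_Icc_pos hL.psi_smooth hL.psi_deriv_pos

lemma IsLorenz.left_mono (hL : IsLorenz 1 ρ u v c φ ψ) {x y : ℝ} (h0 : 0 ≤ x) (hxy : x ≤ y)
    (hc : y < c) : lorenzF ρ u v c φ ψ x ≤ lorenzF ρ u v c φ ψ y := by
  have hc0 := hL.c_pos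
  have hu := hL.u_pos
  have hρ := hL.one_lt_rho
  simp only [lorenzF, if_pos hc, if_pos (hxy.trans_lt hc)]
  have hx := hL.left_arg_mem h0 (hxy.trans hc.le)
  have hy := hL.left_arg_mem (h0.trans hxy) hc.le
  refine hL.phi_strictMonoOn.monotoneOn ⟨hx.1, hx.2.trans hL.u_le_one⟩
    ⟨hy.1, hy.2.trans hL.u_le_one⟩ ?_
  have : 0 ≤ (c - y) / c := div_nonneg (by linarith) hc0.le
  gcongr

lemma IsLorenz.right_mono (hL : IsLorenz 1 ρ u v c φ ψ) {x y : ℝ} (hc : c ≤ x) (hxy : x ≤ y)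
    (h1 : y ≤ 1) : lorenzF ρ u v c φ ψ x ≤ lorenzF ρ u v c φ ψ y := by
  have hc1 : 0 < 1 - c := by linarith [hL.c_lt_one]
  have hv := hL.v_pos
  have hv1 := hL.v_le_one
  have hρ := hL.one_lt_rho
  simp only [lorenzF, if_neg hc.not_gt, if_neg (hc.trans hxy).not_gt]
  have hx := hL.right_arg_mem hc (hxy.trans h1)
  have hy := hL.right_arg_mem (hc.trans hxy) h1
  refine hL.psi_strictMonoOn.monotoneOn ⟨by linarith [hx.1], hx.2⟩
    ⟨by linarith [hy.1], hy.2⟩ ?_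
  have : 0 ≤ (x - c) / (1 - c) := div_nonneg (by linarith) hc1.le
  gcongr

lemma IsLorenz.left_le (hL : IsLorenz 1 ρ u v c φ ψ) {x : ℝ} (h0 : 0 ≤ x) (hc : x < c) :
    lorenzF ρ u v c φ ψ x ≤ φ u := by
  simp only [lorenzF, if_pos hc]
  have hx := hL.left_arg_mem h0 hc.le
  exact hL.phi_strictMonoOn.monotoneOn ⟨hx.1, hx.2.trans hL.u_le_one⟩
    ⟨hL.u_pos.le, hL.u_le_one⟩ hx.2

lemma IsLorenz.le_right (hL : IsLorenz 1 ρ u v c φ ψ) {x : ℝ} (hc : c ≤ x) (h1 : x ≤ 1) :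
    ψ (1 - v) ≤ lorenzF ρ u v c φ ψ x := by
  have hv := hL.v_pos
  have hv1 := hL.v_le_one
  simp only [lorenzF, if_neg hc.not_gt]
  have hx := hL.right_arg_mem hc h1
  exact hL.psi_strictMonoOn.monotoneOn ⟨by linarith, by linarith⟩
    ⟨by linarith [hx.1], hx.2⟩ hx.1

lemma IsLorenz.left_zero (hL : IsLorenz 1 ρ u v c φ ψ) : lorenzF ρ u v c φ ψ 0 = 0 := by
  simp [lorenzF, hL.c_pos, hL.c_pos.ne', hL.phi_zero]

lemma IsLorenz.right_one (hL : IsLorenz 1 ρ u v c φ ψ) : lorenzF ρ u v c φ ψ 1 = 1 := by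
  have : 1 - c ≠ 0 := by linarith [hL.c_lt_one]
  simp [lorenzF, hL.c_lt_one.not_gt, this, hL.psi_one]

lemma IsLorenz.phi_u_pos (hL : IsLorenz 1 ρ u v c φ ψ) : 0 < φ u := by
  have := hL.phi_strictMonoOn ⟨le_rfl, zero_le_one⟩ ⟨hL.u_pos.le, hL.u_le_one⟩ hL.u_pos
  rwa [hL.phi_zero] at this

lemma IsLorenz.psi_lt_one (hL : IsLorenz 1 ρ u v c φ ψ) : ψ (1 - v) < 1 := by
  have hv := hL.v_pos
  have hv1 := hL.v_le_one
  have := hL.psi_strictMonoOn ⟨by linarith, by linarith⟩ ⟨zero_le_one, le_rfl⟩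
    (by linarith : 1 - v < 1)
  rwa [hL.psi_one] at this

lemma IsLorenz.phi_u_le_one (hL : IsLorenz 1 ρ u v c φ ψ) : φ u ≤ 1 := by
  have := hL.phi_strictMonoOn.monotoneOn ⟨hL.u_pos.le, hL.u_le_one⟩ ⟨zero_le_one, le_rfl⟩
    hL.u_le_one
  rwa [hL.phi_one] at this

lemma IsLorenz.psi_nonneg (hL : IsLorenz 1 ρ u v c φ ψ) : 0 ≤ ψ (1 - v) := by
  have hv := hL.v_pos
  have hv1 := hL.v_le_one
  have := hL.psi_strictMonoOn.monotoneOn ⟨le_rfl, zero_le_one⟩ ⟨by linarith, by linarith⟩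
    (by linarith : 0 ≤ 1 - v)
  rwa [hL.psi_zero] at this

/-- Derivative bound for the left branch. -/
lemma IsLorenz.left_sub_le (hL : IsLorenz 1 ρ u v c φ ψ) (hd : DistBound φ π) {x y : ℝ}
    (h0 : 0 ≤ x) (hxy : x ≤ y) (hc : y < c) :
    lorenzF ρ u v c φ ψ y - lorenzF ρ u v c φ ψ x ≤
      (y - x) * ((c - x) / c) ^ (ρ - 1) / kappaC ρ π c (φ u) := by
  have hc0 := hL.c_pos
  have hu := hL.u_pos
  have hρ := hL.one_lt_rho
  have ha := hL.phi_u_pos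
  have hx := hL.left_arg_mem h0 (hxy.trans hc.le)
  have hy := hL.left_arg_mem (h0.trans hxy) hc.le
  have hy0 : 0 ≤ (c - y) / c := div_nonneg (by linarith) hc0.le
  have hyx : (c - y) / c ≤ (c - x) / c := by gcongr
  have hpow := Real.rpow_le_rpow hy0 hyx (by linarith : 0 ≤ ρ)
  have hdist := hd.sub_mul_sub_le hL.phi_smooth hL.phi_deriv_pos hx.1
    (mul_le_mul_of_nonneg_left (by linarith : 1 - ((c - x) / c) ^ ρ ≤ 1 - ((c - y) / c) ^ ρ) hu.le)
    (hy.2.trans hL.u_le_one) le_rfl hu.le hL.u_le_one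
  rw [hL.phi_zero, sub_zero, sub_zero] at hdist
  have htan := rpow_sub_rpow_le_s9 hρ hy0 hyx
  simp only [lorenzF, if_pos hc, if_pos (hxy.trans_lt hc)]
  refine le_of_mul_le_mul_right (hdist.trans ?_) hu
  calc Real.exp π * φ u * (u * (1 - ((c - y) / c) ^ ρ) - u * (1 - ((c - x) / c) ^ ρ))
      = Real.exp π * φ u * u * (((c - x) / c) ^ ρ - ((c - y) / c) ^ ρ) := by ring
    _ ≤ Real.exp π * φ u * u * (ρ * ((c - x) / c) ^ (ρ - 1) * ((c - x) / c - (c - y) / c)) := by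
      gcongr
    _ = _ := by
      rw [kappaC, Real.exp_neg]
      generalize ((c - x) / c) ^ (ρ - 1) = w
      field_simp
      ring

/-- Derivative bound for the right branch. -/
lemma IsLorenz.right_sub_le (hL : IsLorenz 1 ρ u v c φ ψ) (hd : DistBound ψ π) {x y : ℝ}
    (hc : c ≤ x) (hxy : x ≤ y) (h1 : y ≤ 1) :
    lorenzF ρ u v c φ ψ y - lorenzF ρ u v c φ ψ x ≤
      (y - x) * ((y - c) / (1 - c)) ^ (ρ - 1) / etaC ρ π c (ψ (1 - v)) := by
  have hc0 : 0 < 1 - c := by linarith [hL.c_lt_one]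
  have hv := hL.v_pos
  have hv1 := hL.v_le_one
  have hρ := hL.one_lt_rho
  have hb : 0 < 1 - ψ (1 - v) := by linarith [hL.psi_lt_one]
  have hx := hL.right_arg_mem hc (hxy.trans h1)
  have hy := hL.right_arg_mem (hc.trans hxy) h1
  have hx0 : 0 ≤ (x - c) / (1 - c) := div_nonneg (by linarith) hc0.le
  have hyx : (x - c) / (1 - c) ≤ (y - c) / (1 - c) := by gcongr
  have hpow := Real.rpow_le_rpow hx0 hyx (by linarith : 0 ≤ ρ)
  have hdist := hd.sub_mul_sub_le hL.psi_smooth hL.psi_deriv_pos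
    (s := 1 + v * (-1 + ((x - c) / (1 - c)) ^ ρ)) (t := 1 + v * (-1 + ((y - c) / (1 - c)) ^ ρ))
    (s' := 1 - v) (t' := 1) (by linarith [hx.1]) (by gcongr) hy.2 (by linarith) (by linarith) le_rfl
  rw [hL.psi_one, sub_sub_cancel] at hdist
  have htan := rpow_sub_rpow_le_s9 hρ hx0 hyx
  simp only [lorenzF, if_neg hc.not_gt, if_neg (hc.trans hxy).not_gt]
  refine le_of_mul_le_mul_right (hdist.trans ?_) hv
  calc Real.exp π * (1 - ψ (1 - v)) * (1 + v * (-1 + ((y - c) / (1 - c)) ^ ρ)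
          - (1 + v * (-1 + ((x - c) / (1 - c)) ^ ρ)))
      = Real.exp π * (1 - ψ (1 - v)) * v *
          (((y - c) / (1 - c)) ^ ρ - ((x - c) / (1 - c)) ^ ρ) := by ring
    _ ≤ Real.exp π * (1 - ψ (1 - v)) * v * (ρ * ((y - c) / (1 - c)) ^ (ρ - 1) *
          ((y - c) / (1 - c) - (x - c) / (1 - c))) := by
      gcongr
    _ = _ := by
      rw [etaC, Real.exp_neg]
      generalize ((y - c) / (1 - c)) ^ (ρ - 1) = w
      field_simp
      ring

/-- Power law of the left branch at the critical point. -/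
lemma IsLorenz.phi_u_sub_le (hL : IsLorenz 1 ρ u v c φ ψ) (hd : DistBound φ π) {x : ℝ}
    (h0 : 0 ≤ x) (hc : x < c) :
    φ u - lorenzF ρ u v c φ ψ x ≤ Real.exp π * φ u * ((c - x) / c) ^ ρ := by
  have hu := hL.u_pos
  have hx := hL.left_arg_mem h0 hc.le
  have hdist := hd.sub_mul_sub_le hL.phi_smooth hL.phi_deriv_pos hx.1 hx.2 hL.u_le_one
    le_rfl hu.le hL.u_le_one
  rw [hL.phi_zero, sub_zero, sub_zero] at hdist
  simp only [lorenzF, if_pos hc]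
  refine le_of_mul_le_mul_right (hdist.trans (le_of_eq ?_)) hu
  ring

/-- Power law of the right branch at the critical point. -/
lemma IsLorenz.sub_psi_le (hL : IsLorenz 1 ρ u v c φ ψ) (hd : DistBound ψ π) {x : ℝ}
    (hc : c ≤ x) (h1 : x ≤ 1) :
    lorenzF ρ u v c φ ψ x - ψ (1 - v) ≤
      Real.exp π * (1 - ψ (1 - v)) * ((x - c) / (1 - c)) ^ ρ := by
  have hv := hL.v_pos
  have hv1 := hL.v_le_one
  have hx := hL.right_arg_mem hc h1
  have hdist := hd.sub_mul_sub_le hL.psi_smooth hL.psi_deriv_pos (by linarith) hx.1 hx.2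
    (s' := 1 - v) (by linarith) (by linarith) le_rfl
  rw [hL.psi_one, sub_sub_cancel] at hdist
  simp only [lorenzF, if_neg hc.not_gt]
  refine le_of_mul_le_mul_right (hdist.trans (le_of_eq ?_)) hv
  ring

end Branches

/-- A number below `b + K * s ^ ρ` for all small `s > 0` is at most `b`. -/
lemma le_of_forall_le_add_mul_rpow {ρ w b K δ : ℝ} (hρ : 0 < ρ) (hδ : 0 < δ)
    (h : ∀ s, 0 < s → s ≤ δ → w ≤ b + K * s ^ ρ) : w ≤ b := by
  have hcont : ContinuousAt (fun s : ℝ => b + K * s ^ ρ) 0 :=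
    continuousAt_const.add (continuousAt_const.mul (Real.continuousAt_rpow_const 0 ρ (.inr hρ.le)))
  have ht : Filter.Tendsto (fun s : ℝ => b + K * s ^ ρ) (nhdsWithin 0 (Ioi 0)) (nhds b) := by
    have := hcont.tendsto.mono_left (nhdsWithin_le_nhds (s := Ioi 0))
    simpa [Real.zero_rpow hρ.ne'] using this
  refine ge_of_tendsto ht ?_
  filter_upwards [Ioc_mem_nhdsGT hδ] with s hs using h s hs.1 hs.2

section Renormalization

variable {ρ u v c π p q : ℝ} {φ ψ : ℝ → ℝ} {n m : ℕ}

lemma MonotoneRenorm.left_orbit (hren : MonotoneRenorm ρ u v c φ ψ n m p q) {x : ℝ}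
    (hx : x ∈ Ico p c) {k : ℕ} (hk : k < n) :
    q < (lorenzF ρ u v c φ ψ)^[k + 1] x ∧ (lorenzF ρ u v c φ ψ)^[k + 1] x ≤ 1 := by
  obtain ⟨h1, h2⟩ := hren.left_iter (k + 1) (by omega) (by omega)
  have hm := mem_image_of_mem (lorenzF ρ u v c φ ψ)^[k + 1] hx
  have hmem := h1 hm
  refine ⟨lt_of_not_ge fun hle => disjoint_left.1 h2 hm ⟨?_, hle⟩, hmem.2⟩
  linarith [hmem.1, hren.p_lt_c]

lemma MonotoneRenorm.right_orbit (hren : MonotoneRenorm ρ u v c φ ψ n m p q) {x : ℝ}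
    (hx : x ∈ Ioc c q) {k : ℕ} (hk : k < m) :
    0 ≤ (lorenzF ρ u v c φ ψ)^[k + 1] x ∧ (lorenzF ρ u v c φ ψ)^[k + 1] x < p := by
  obtain ⟨h1, h2⟩ := hren.right_iter (k + 1) (by omega) (by omega)
  have hm := mem_image_of_mem (lorenzF ρ u v c φ ψ)^[k + 1] hx
  have hmem := h1 hm
  refine ⟨hmem.1, lt_of_not_ge fun hle => disjoint_left.1 h2 hm ⟨hle, ?_⟩⟩
  linarith [hmem.2, hren.c_lt_q]

lemma MonotoneRenorm.psi_lt_p (hren : MonotoneRenorm ρ u v c φ ψ n m p q)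
    (hL : IsLorenz 1 ρ u v c φ ψ) : ψ (1 - v) < p :=
  (hL.le_right hren.c_lt_q.le hren.q_lt_one.le).trans_lt
    (hren.right_orbit ⟨hren.c_lt_q, le_rfl⟩ (k := 0) hren.m_pos).2

lemma MonotoneRenorm.q_lt_phi (hren : MonotoneRenorm ρ u v c φ ψ n m p q)
    (hL : IsLorenz 1 ρ u v c φ ψ) : q < φ u :=
  (hren.left_orbit ⟨le_rfl, hren.p_lt_c⟩ (k := 0) hren.n_pos).1.trans_le
    (hL.left_le hren.p_pos.le hren.p_lt_c)

lemma MonotoneRenorm.map_psi_lt (hren : MonotoneRenorm ρ u v c φ ψ n m p q)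
    (hL : IsLorenz 1 ρ u v c φ ψ) : lorenzF ρ u v c φ ψ (ψ (1 - v)) < c := by
  rcases hren.m_pos.eq_or_lt with hm | hm
  · simpa [← hm] using hren.nontrivial_right
  · have hq : q ∈ Ioc c q := ⟨hren.c_lt_q, le_rfl⟩
    have h1 := (hren.right_orbit hq (k := 0) hren.m_pos).2
    have h2 := (hren.right_orbit hq (k := 1) hm).2
    exact (hL.left_mono hL.psi_nonneg (hL.le_right hren.c_lt_q.le hren.q_lt_one.le)
      (h1.trans hren.p_lt_c)).trans_lt (h2.trans hren.p_lt_c)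

lemma MonotoneRenorm.lt_map_phi (hren : MonotoneRenorm ρ u v c φ ψ n m p q)
    (hL : IsLorenz 1 ρ u v c φ ψ) : c < lorenzF ρ u v c φ ψ (φ u) := by
  rcases hren.n_pos.eq_or_lt with hn | hn
  · simpa [← hn] using hren.nontrivial_left
  · have hp : p ∈ Ico p c := ⟨le_rfl, hren.p_lt_c⟩
    have h1 := (hren.left_orbit hp (k := 0) hren.n_pos).1
    have h2 := (hren.left_orbit hp (k := 1) hn).1
    exact (hren.c_lt_q.trans h2).trans_le (hL.right_mono (hren.c_lt_q.trans h1).le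
      (hL.left_le hren.p_pos.le hren.p_lt_c) hL.phi_u_le_one)

lemma MonotoneRenorm.pow_kappa_mul_le (hren : MonotoneRenorm ρ u v c φ ψ n m p q)
    (hL : IsLorenz 1 ρ u v c φ ψ) (hφd : DistBound φ π) (hψd : DistBound ψ π) :
    kappaC ρ π c (φ u) ^ m * p ≤ ψ (1 - v) := by
  have hc0 := hL.c_pos
  have hμ : 0 < 1 - c := by linarith [hL.c_lt_one]
  have hρ := hL.one_lt_rho
  have ha := hL.phi_u_pos
  have hκ : 0 < kappaC ρ π c (φ u) := by unfold kappaC; positivity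
  have hq := hren.q_lt_one
  refine le_of_forall_le_add_mul_rpow (δ := (q - c) / (1 - c))
    (K := Real.exp π * (1 - ψ (1 - v))) (by linarith : 0 < ρ)
    (div_pos (by linarith [hren.c_lt_q]) hμ) fun s hs hsδ => ?_
  rw [le_div_iff₀ hμ] at hsδ
  have hsμ : 0 < s * (1 - c) := by positivity
  have hx : c + s * (1 - c) ∈ Ioc c q := ⟨by linarith, by linarith⟩
  have hpow := hL.sub_psi_le hψd hx.1.le (by linarith [hx.2])
  rw [add_sub_cancel_left, mul_div_cancel_right₀ _ hμ.ne'] at hpow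
  have hret := (hren.right_return hx).1
  have hiter := pow_mul_le_of_le_div hκ (m := m)
    (x := fun k => (lorenzF ρ u v c φ ψ)^[k + 1] (c + s * (1 - c))) fun k hk => by
      obtain ⟨h0, h1⟩ := hren.right_orbit hx hk
      have h := hL.left_sub_le hφd le_rfl h0 (h1.trans hren.p_lt_c)
      rw [Function.iterate_succ_apply']
      simpa [hL.left_zero, hc0.ne'] using h
  simp only [zero_add, Function.iterate_one] at hiter
  have := mul_le_mul_of_nonneg_left hret (pow_pos hκ m).le
  linarith

lemma MonotoneRenorm.pow_eta_mul_le (hren : MonotoneRenorm ρ u v c φ ψ n m p q)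
    (hL : IsLorenz 1 ρ u v c φ ψ) (hφd : DistBound φ π) (hψd : DistBound ψ π) :
    etaC ρ π c (ψ (1 - v)) ^ n * (1 - q) ≤ 1 - φ u := by
  have hc0 := hL.c_pos
  have hμ : 0 < 1 - c := by linarith [hL.c_lt_one]
  have hρ := hL.one_lt_rho
  have hb : 0 < 1 - ψ (1 - v) := by linarith [hL.psi_lt_one]
  have hη : 0 < etaC ρ π c (ψ (1 - v)) := by unfold etaC; positivity
  have hp := hren.p_pos
  refine le_of_forall_le_add_mul_rpow (δ := (c - p) / c)
    (K := Real.exp π * φ u) (by linarith : 0 < ρ)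
    (div_pos (by linarith [hren.p_lt_c]) hc0) fun s hs hsδ => ?_
  rw [le_div_iff₀ hc0] at hsδ
  have hsc : 0 < s * c := by positivity
  have hx : c - s * c ∈ Ico p c := ⟨by linarith, by linarith⟩
  have hpow := hL.phi_u_sub_le hφd (by linarith [hx.1]) hx.2
  rw [sub_sub_cancel, mul_div_cancel_right₀ _ hc0.ne'] at hpow
  have hret := (hren.left_return hx).2
  have hiter := pow_mul_le_of_le_div hη (m := n)
    (x := fun k => 1 - (lorenzF ρ u v c φ ψ)^[k + 1] (c - s * c)) fun k hk => by
      obtain ⟨h0, h1⟩ := hren.left_orbit hx hk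
      have h := hL.right_sub_le hψd (hren.c_lt_q.trans h0).le h1 le_rfl
      rw [Function.iterate_succ_apply']
      simpa [hL.right_one, hμ.ne'] using h
  simp only [zero_add, Function.iterate_one] at hiter
  have := mul_le_mul_of_nonneg_left (sub_le_sub_left hret 1) (pow_pos hη n).le
  linarith

end Renormalization

/-- For a Lorenz map in `K^π` renormalizable of monotone type `(0 1ⁿ, 1 0ᵐ)`:
`c₁⁺ ≥ κᵐ Δ/(1-κᵐ)` and `1 - c₁⁻ ≥ ηⁿ Θ/(1-ηⁿ)`. -/
theorem critical_value_lower_bounds (ρ u v c π : ℝ) (φ ψ : ℝ → ℝ)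
    (n m : ℕ) (p q : ℝ)
    (hL : IsLorenz 1 ρ u v c φ ψ) (hπ : 0 < π)
    (hφd : DistBound φ π) (hψd : DistBound ψ π)
    (hren : MonotoneRenorm ρ u v c φ ψ n m p q) :
    kappaC ρ π c (φ u) ^ m * DeltaC ρ π c (φ u) (ψ (1 - v)) n /
        (1 - kappaC ρ π c (φ u) ^ m) ≤ ψ (1 - v) ∧
      etaC ρ π c (ψ (1 - v)) ^ n * ThetaC ρ π c (φ u) (ψ (1 - v)) m /
        (1 - etaC ρ π c (ψ (1 - v)) ^ n) ≤ 1 - φ u := by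
  have hc0 := hL.c_pos
  have hc1 := hL.c_lt_one
  have hpc := hren.p_lt_c
  have hcq := hren.c_lt_q
  have hp0 := hren.p_pos
  have hq1 := hren.q_lt_one
  have hbp := hren.psi_lt_p hL
  have hqa := hren.q_lt_phi hL
  have hp : p ∈ Ico p c := ⟨le_rfl, hpc⟩
  have hq : q ∈ Ioc c q := ⟨hcq, le_rfl⟩
  constructor
  · refine lower_bound_of_orbit (z := fun k => (lorenzF ρ u v c φ ψ)^[k + 1] p) (p := p)
      hL.one_lt_rho hπ hc0 hc1 (hcq.trans hqa) hL.psi_nonneg hbp hpc hren.n_pos hren.m_pos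
      (fun k hk => (hcq.trans (hren.left_orbit hp hk).1).le) (fun k hk => ?_) hren.left_fix ?_
      (hren.pow_kappa_mul_le hL hφd hψd)
    · obtain ⟨h1, h2⟩ := hren.left_orbit hp hk
      rw [Function.iterate_succ_apply']
      exact hL.sub_psi_le hψd (hcq.trans h1).le h2
    · have h := hL.left_sub_le hφd hL.psi_nonneg hbp.le hpc
      have := hren.map_psi_lt hL
      simp only [zero_add, Function.iterate_one]
      linarith
  · have hΘ : ThetaC ρ π c (φ u) (ψ (1 - v)) m =
        DeltaC ρ π (1 - c) (1 - ψ (1 - v)) (1 - φ u) m := by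
      have h1 : 1 - c - (1 - φ u) = φ u - c := by ring
      simp only [ThetaC, DeltaC, etaC, kappaC, xiC, nuC, sub_sub_cancel, h1]
    rw [hΘ]
    refine lower_bound_of_orbit (c := 1 - c) (a := 1 - ψ (1 - v)) (b := 1 - φ u)
      (z := fun k => 1 - (lorenzF ρ u v c φ ψ)^[k + 1] q) (p := 1 - q)
      hL.one_lt_rho hπ (by linarith) (by linarith) (by linarith)
      (by linarith [hL.phi_u_le_one]) (by linarith) (by linarith) hren.m_pos hren.n_pos
      (fun k hk => by linarith [(hren.right_orbit hq hk).2]) (fun k hk => ?_)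
      (congrArg (1 - ·) hren.right_fix) ?_ (hren.pow_eta_mul_le hL hφd hψd)
    · obtain ⟨h1, h2⟩ := hren.right_orbit hq hk
      rw [Function.iterate_succ_apply']
      have h := hL.phi_u_sub_le hφd h1 (h2.trans hpc)
      simpa only [sub_sub_sub_cancel_left, sub_sub_cancel] using h
    · have h := hL.right_sub_le hψd hcq.le hqa.le hL.phi_u_le_one
      have := hren.lt_map_phi hL
      simp only [zero_add, Function.iterate_one, sub_sub_sub_cancel_left]
      change _ ≤ _ / etaC ρ π c (ψ (1 - v))
      linarith
end
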